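/- Suppose 0 ≤ E < T ≤ N, the messages are mutually independent with H(W_k) = L for every k, E-security holds, T-privacy holds, and for some k ∈ [1:K−1] ε-correctness holds for message k+1. Then for every subset ℰ ⊆ [1:N] with |ℰ| = E, H(A_{[1:N]∖ℰ}^{[k]} | W_1,…,W_k, A_ℰ^{[k]}, Q_{[1:N]}^{[k]}) ≥ ((T−E)/(N−E)) · ( H(A_{[1:N]∖ℰ}^{[k+1]} | W_1,…,W_{k+1}, A_ℰ^{[k+1]}, Q_{[1:N]}^{[k+1]}) + L − ε ). -/

import Mathlib

open Finset

/-- Probability that the finitely-valued random variable `X` (on the finite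
probability space with pmf `p`) takes the value `x`. -/
noncomputable def prC {Ω α : Type*} [Fintype Ω] [DecidableEq α]
    (p : Ω → ℝ) (X : Ω → α) (x : α) : ℝ :=
  ∑ ω, if X ω = x then p ω else 0

/-- Shannon entropy `H(X)` of a finitely-valued random variable. -/
noncomputable def entH {Ω α : Type*} [Fintype Ω] [Fintype α] [DecidableEq α]
    (p : Ω → ℝ) (X : Ω → α) : ℝ :=
  -∑ x, prC p X x * Real.log (prC p X x)

/-- Conditional entropy `H(X|Y) = H(X,Y) - H(Y)`. -/
noncomputable def condEntH {Ω α β : Type*} [Fintype Ω] [Fintype α] [DecidableEq α]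
    [Fintype β] [DecidableEq β] (p : Ω → ℝ) (X : Ω → α) (Y : Ω → β) : ℝ :=
  entH p (fun ω => (X ω, Y ω)) - entH p Y

/-- Mutual information `I(X;Y) = H(X) + H(Y) - H(X,Y)`. -/
noncomputable def mutInfH {Ω α β : Type*} [Fintype Ω] [Fintype α] [DecidableEq α]
    [Fintype β] [DecidableEq β] (p : Ω → ℝ) (X : Ω → α) (Y : Ω → β) : ℝ :=
  entH p X + entH p Y - entH p (fun ω => (X ω, Y ω))


section PartitionEntropy

open scoped Classical in
/-- Probability of the class of `ω` in the partition `r`. -/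
noncomputable def classPr {Ω : Type*} [Fintype Ω] (p : Ω → ℝ) (r : Setoid Ω) (ω : Ω) : ℝ :=
  ∑ ω', if r ω ω' then p ω' else 0

/-- Shannon entropy of a partition of the sample space. -/
noncomputable def partH {Ω : Type*} [Fintype Ω] (p : Ω → ℝ) (r : Setoid Ω) : ℝ :=
  -∑ ω, p ω * Real.log (classPr p r ω)

variable {Ω : Type*} [Fintype Ω] {p : Ω → ℝ}

theorem prC_eq_classPr {α : Type*} [DecidableEq α] (p : Ω → ℝ) (X : Ω → α) (ω : Ω) :
    prC p X (X ω) = classPr p (Setoid.ker X) ω := by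
  unfold prC classPr
  refine Finset.sum_congr rfl fun ω' _ => ?_
  simp [Setoid.ker_def, eq_comm]

theorem sum_prC_mul {α : Type*} [Fintype α] [DecidableEq α] (p : Ω → ℝ) (X : Ω → α)
    (g : α → ℝ) : ∑ x, prC p X x * g x = ∑ ω, p ω * g (X ω) := by
  simp only [prC, Finset.sum_mul, ite_mul, zero_mul]
  rw [Finset.sum_comm]
  simp

theorem entH_eq_partH {α : Type*} [Fintype α] [DecidableEq α] (p : Ω → ℝ) (X : Ω → α) :
    entH p X = partH p (Setoid.ker X) := by
  unfold entH partH
  rw [sum_prC_mul p X fun x => Real.log (prC p X x)]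
  simp only [prC_eq_classPr]

theorem classPr_congr {r : Setoid Ω} {ω ω' : Ω} (h : r ω ω') :
    classPr p r ω = classPr p r ω' := by
  classical
  unfold classPr
  refine Finset.sum_congr rfl fun x _ => ?_
  have : r ω x ↔ r ω' x := ⟨fun hx => r.trans (r.symm h) hx, fun hx => r.trans h hx⟩
  simp [this]

theorem classPr_nonneg (hp0 : ∀ ω, 0 ≤ p ω) (r : Setoid Ω) (ω : Ω) : 0 ≤ classPr p r ω := by
  unfold classPr
  exact Finset.sum_nonneg fun x _ => by split_ifs <;> simp [hp0]

theorem le_classPr (hp0 : ∀ ω, 0 ≤ p ω) (r : Setoid Ω) (ω : Ω) : p ω ≤ classPr p r ω := by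
  classical
  unfold classPr
  have := Finset.single_le_sum (f := fun ω' => if r ω ω' then p ω' else 0)
    (fun x _ => by split_ifs <;> simp [hp0]) (Finset.mem_univ ω)
  simpa [r.refl ω] using this

theorem classPr_mono (hp0 : ∀ ω, 0 ≤ p ω) {r s : Setoid Ω} (h : r ≤ s) (ω : Ω) :
    classPr p r ω ≤ classPr p s ω := by
  unfold classPr
  refine Finset.sum_le_sum fun x _ => ?_
  by_cases hr : r ω x
  · simp [hr, h hr]
  · rw [if_neg hr]
    split_ifs <;> simp [hp0]

theorem partH_anti (hp0 : ∀ ω, 0 ≤ p ω) {r s : Setoid Ω} (h : r ≤ s) :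
    partH p s ≤ partH p r := by
  unfold partH
  refine neg_le_neg (Finset.sum_le_sum fun ω _ => ?_)
  rcases (hp0 ω).eq_or_lt with h0 | h0
  · simp [← h0]
  · exact mul_le_mul_of_nonneg_left (Real.log_le_log (h0.trans_le (le_classPr hp0 r ω))
      (classPr_mono hp0 h ω)) h0.le

theorem sum_classPr_ratio_le (hp0 : ∀ ω, 0 ≤ p ω) (hp1 : ∑ ω, p ω = 1) {x y z : Setoid Ω}
    (hx : x ≤ z) (hy : y ≤ z) :
    ∑ ω, p ω * (classPr p x ω * classPr p y ω / (classPr p (x ⊓ y) ω * classPr p z ω)) ≤ 1 := by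
  classical
  have key : ∀ α β, ∑ ω, (if x ω α ∧ y ω β then
      p ω / (classPr p (x ⊓ y) ω * classPr p z ω) else 0) ≤
      if z α β then (classPr p z α)⁻¹ else 0 := by
    intro α β
    by_cases hex : ∃ ω₀, x ω₀ α ∧ y ω₀ β
    · obtain ⟨ω₀, h1, h2⟩ := hex
      have hz : z α β := z.trans (z.symm (hx h1)) (hy h2)
      rw [if_pos hz]
      have hterm : ∀ ω, (if x ω α ∧ y ω β then
          p ω / (classPr p (x ⊓ y) ω * classPr p z ω) else 0) =
          (if (x ⊓ y) ω₀ ω then p ω else 0) *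
            ((classPr p (x ⊓ y) ω₀)⁻¹ * (classPr p z α)⁻¹) := by
        intro ω
        have hiff : (x ω α ∧ y ω β) ↔ (x ⊓ y) ω₀ ω := by
          refine Iff.trans ?_ Setoid.inf_iff_and.symm
          exact ⟨fun h => ⟨x.trans h1 (x.symm h.1), y.trans h2 (y.symm h.2)⟩,
            fun h => ⟨x.trans (x.symm h.1) h1, y.trans (y.symm h.2) h2⟩⟩
        by_cases h : x ω α ∧ y ω β
        · rw [if_pos h, if_pos (hiff.1 h), classPr_congr (hiff.1 h), classPr_congr (hx h.1),
            div_eq_mul_inv, mul_inv]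
        · rw [if_neg h, if_neg (fun h' => h (hiff.2 h')), zero_mul]
      rw [Finset.sum_congr rfl fun ω _ => hterm ω, ← Finset.sum_mul, ← mul_assoc]
      refine mul_le_of_le_one_left (inv_nonneg.2 (classPr_nonneg hp0 _ _)) ?_
      exact mul_inv_le_one
    · push Not at hex
      rw [Finset.sum_eq_zero fun ω _ => if_neg fun h => hex ω h.1 h.2]
      split_ifs
      · exact inv_nonneg.2 (classPr_nonneg hp0 _ _)
      · exact le_rfl
  calc ∑ ω, p ω * (classPr p x ω * classPr p y ω / (classPr p (x ⊓ y) ω * classPr p z ω))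
      = ∑ α, ∑ β, p α * p β * ∑ ω, (if x ω α ∧ y ω β then
          p ω / (classPr p (x ⊓ y) ω * classPr p z ω) else 0) := by
        have : ∀ ω, p ω * (classPr p x ω * classPr p y ω /
            (classPr p (x ⊓ y) ω * classPr p z ω)) = ∑ α, ∑ β, p α * p β *
            (if x ω α ∧ y ω β then p ω / (classPr p (x ⊓ y) ω * classPr p z ω) else 0) := by
          intro ω
          have hprod : classPr p x ω * classPr p y ω = ∑ α, ∑ β,
              (if x ω α then p α else 0) * (if y ω β then p β else 0) := by
            simp only [classPr]
            rw [Finset.sum_mul_sum]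
          rw [hprod, Finset.sum_div, Finset.mul_sum]
          refine Finset.sum_congr rfl fun α _ => ?_
          rw [Finset.sum_div, Finset.mul_sum]
          refine Finset.sum_congr rfl fun β _ => ?_
          by_cases h1 : x ω α <;> by_cases h2 : y ω β <;> simp [h1, h2]
          ring
        rw [Finset.sum_congr rfl fun ω _ => this ω, Finset.sum_comm]
        refine Finset.sum_congr rfl fun α _ => ?_
        rw [Finset.sum_comm]
        exact Finset.sum_congr rfl fun β _ => by rw [Finset.mul_sum]
    _ ≤ ∑ α, ∑ β, p α * p β * (if z α β then (classPr p z α)⁻¹ else 0) := by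
        refine Finset.sum_le_sum fun α _ => Finset.sum_le_sum fun β _ => ?_
        exact mul_le_mul_of_nonneg_left (key α β) (mul_nonneg (hp0 α) (hp0 β))
    _ = ∑ α, p α * (classPr p z α * (classPr p z α)⁻¹) := by
        refine Finset.sum_congr rfl fun α _ => ?_
        conv_rhs => rw [classPr, Finset.sum_mul, Finset.mul_sum]
        refine Finset.sum_congr rfl fun β _ => ?_
        by_cases h : z α β <;> simp [h, classPr, mul_assoc]
    _ ≤ ∑ α, p α := Finset.sum_le_sum fun α _ =>
        mul_le_of_le_one_right (hp0 α) mul_inv_le_one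
    _ = 1 := hp1

/-- Submodularity of entropy. -/
theorem partH_submodular (hp0 : ∀ ω, 0 ≤ p ω) (hp1 : ∑ ω, p ω = 1) {x y z : Setoid Ω}
    (hx : x ≤ z) (hy : y ≤ z) :
    partH p (x ⊓ y) + partH p z ≤ partH p x + partH p y := by
  have hpt : ∀ ω, p ω * Real.log (classPr p x ω) + p ω * Real.log (classPr p y ω) -
      p ω * Real.log (classPr p (x ⊓ y) ω) - p ω * Real.log (classPr p z ω) ≤
      p ω * (classPr p x ω * classPr p y ω / (classPr p (x ⊓ y) ω * classPr p z ω)) - p ω := by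
    intro ω
    rcases (hp0 ω).eq_or_lt with h0 | h0
    · simp [← h0]
    · have hpos : ∀ r : Setoid Ω, 0 < classPr p r ω := fun r => h0.trans_le (le_classPr hp0 r ω)
      have h1 := Real.log_le_sub_one_of_pos
        (div_pos (mul_pos (hpos x) (hpos y)) (mul_pos (hpos (x ⊓ y)) (hpos z)))
      rw [Real.log_div (mul_pos (hpos x) (hpos y)).ne' (mul_pos (hpos (x ⊓ y)) (hpos z)).ne',
        Real.log_mul (hpos x).ne' (hpos y).ne', Real.log_mul (hpos (x ⊓ y)).ne' (hpos z).ne'] at h1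
      have := mul_le_mul_of_nonneg_left h1 h0.le
      linarith
  have hsum := Finset.sum_le_sum fun ω (_ : ω ∈ Finset.univ) => hpt ω
  simp only [Finset.sum_sub_distrib, Finset.sum_add_distrib] at hsum
  have := sum_classPr_ratio_le hp0 hp1 hx hy
  unfold partH
  linarith

theorem partH_submodular' (hp0 : ∀ ω, 0 ≤ p ω) (hp1 : ∑ ω, p ω = 1) {x y z u : Setoid Ω}
    (hx : x ≤ z) (hy : y ≤ z) (hu : x ⊓ y ≤ u) :
    partH p u + partH p z ≤ partH p x + partH p y :=
  (add_le_add_left (partH_anti hp0 hu) _).trans (partH_submodular hp0 hp1 hx hy)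

theorem partH_top (hp1 : ∑ ω, p ω = 1) : partH p ⊤ = 0 := by
  simp [partH, classPr, Setoid.top_def, hp1]

theorem partH_inf_le (hp0 : ∀ ω, 0 ≤ p ω) (hp1 : ∑ ω, p ω = 1) (x y : Setoid Ω) :
    partH p (x ⊓ y) ≤ partH p x + partH p y := by
  have := partH_submodular hp0 hp1 (le_top : x ≤ ⊤) (le_top : y ≤ ⊤)
  rwa [partH_top hp1, add_zero] at this

theorem partH_iInf_inf_le (hp0 : ∀ ω, 0 ≤ p ω) (hp1 : ∑ ω, p ω = 1) {ι : Type*}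
    (f : ι → Setoid Ω) (s : Finset ι) (y : Setoid Ω) :
    partH p ((⨅ i ∈ s, f i) ⊓ y) ≤ ∑ i ∈ s, partH p (f i) + partH p y := by
  classical
  induction s using Finset.induction_on with
  | empty => simp
  | insert i s hi ih =>
    rw [Finset.iInf_insert, Finset.sum_insert hi, inf_assoc]
    have := partH_inf_le hp0 hp1 (f i) ((⨅ i ∈ s, f i) ⊓ y)
    linarith

theorem entH_comp_congr {α β : Type*} [Fintype α] [DecidableEq α] [Fintype β] [DecidableEq β]
    {X Y : Ω → α} (h : ∀ x, prC p X x = prC p Y x) (f : α → β) :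
    entH p (fun ω => f (X ω)) = entH p (fun ω => f (Y ω)) := by
  have : ∀ b, prC p (fun ω => f (X ω)) b = prC p (fun ω => f (Y ω)) b := by
    intro b
    have hX := sum_prC_mul p X fun a => if f a = b then 1 else 0
    have hY := sum_prC_mul p Y fun a => if f a = b then 1 else 0
    simp only [h, mul_ite, mul_one, mul_zero] at hX hY
    simp only [prC]
    exact hX.symm.trans hY
  simp only [entH, this]

theorem entH_pi_of_independent (hp0 : ∀ ω, 0 ≤ p ω) {ι α : Type*} [Fintype ι]
    [DecidableEq α] [Fintype α] [DecidableEq ι] (X : ι → Ω → α)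
    (h : ∀ x : ι → α, prC p (fun ω i => X i ω) x = ∏ i, prC p (X i) (x i)) :
    entH p (fun ω i => X i ω) = ∑ i, entH p (X i) := by
  simp only [entH_eq_partH, partH]
  rw [Finset.sum_neg_distrib, Finset.sum_comm]
  congr 1
  refine Finset.sum_congr rfl fun ω _ => ?_
  rw [← prC_eq_classPr p (fun ω i => X i ω), h]
  rcases (hp0 ω).eq_or_lt with h0 | h0
  · simp [← h0]
  · rw [Real.log_prod fun i _ => ?_, Finset.mul_sum]
    · simp only [prC_eq_classPr]
    · rw [prC_eq_classPr]
      exact (h0.trans_le (le_classPr hp0 _ ω)).ne'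

end PartitionEntropy

section SubmodularAveraging

variable {ι : Type*} [DecidableEq ι] {g : Finset ι → ℝ}

theorem sum_sub_erase_le (hg : ∀ s t, g (s ∪ t) + g (s ∩ t) ≤ g s + g t) (R s : Finset ι)
    (hs : s ⊆ R) : ∑ i ∈ s, (g R - g (R.erase i)) ≤ g s - g ∅ := by
  induction s using Finset.induction_on with
  | empty => simp
  | insert i s hi ih =>
    rw [Finset.sum_insert hi]
    have h1 := ih fun j hj => hs (Finset.mem_insert_of_mem hj)
    have h2 := hg (insert i s) (R.erase i)
    have hiR := hs (Finset.mem_insert_self i s)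
    have hu : insert i s ∪ R.erase i = R := by
      ext j
      by_cases hj : j = i
      · simp [hj, hiR]
      · have := @hs j
        simp_all
    have hn : insert i s ∩ R.erase i = s := by
      ext j
      by_cases hj : j = i
      · simp [hj, hi]
      · have := @hs j
        simp_all
    rw [hu, hn] at h2
    linarith

/-- Han's inequality, in the form: some subset of each size attains the average increment. -/
theorem exists_subset_card_eq_han (hg : ∀ s t, g (s ∪ t) + g (s ∩ t) ≤ g s + g t) (F : Finset ι)
    (m d : ℕ) (hF : F.card = m + d) :
    ∃ R ⊆ F, R.card = m ∧ (m : ℝ) * (g F - g ∅) ≤ F.card * (g R - g ∅) := by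
  induction d generalizing m with
  | zero => exact ⟨F, Finset.Subset.refl _, by simpa using hF, by simp [hF]⟩
  | succ d ih =>
    obtain ⟨R, hRF, hR, hle⟩ := ih (m + 1) (by omega)
    have hne : R.Nonempty := Finset.card_pos.1 (by omega)
    have hsum := sum_sub_erase_le hg R R (Finset.Subset.refl _)
    obtain ⟨i, hi, hii⟩ : ∃ i ∈ R, g R - g (R.erase i) ≤ (g R - g ∅) / R.card := by
      refine Finset.exists_le_of_sum_le hne (hsum.trans_eq ?_)
      rw [Finset.sum_const, nsmul_eq_mul, mul_div_cancel₀]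
      exact_mod_cast (by omega : R.card ≠ 0)
    refine ⟨R.erase i, (Finset.erase_subset _ _).trans hRF, by
      rw [Finset.card_erase_of_mem hi, hR]; rfl, ?_⟩
    rw [hR] at hii
    push_cast at hii hle
    have hm : (0 : ℝ) < (m : ℝ) + 1 := by positivity
    rw [le_div_iff₀ hm] at hii
    have hFn : (0 : ℝ) ≤ F.card := by positivity
    have h3 : (m : ℝ) * (g R - g ∅) ≤ (m + 1) * (g (R.erase i) - g ∅) := by nlinarith
    have h4 := mul_le_mul_of_nonneg_left h3 hFn
    have h5 := mul_le_mul_of_nonneg_left hle (Nat.cast_nonneg (α := ℝ) m)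
    refine le_of_mul_le_mul_left ?_ hm
    linarith

end SubmodularAveraging

section SetoidKer

variable {Ω : Type*}

theorem Setoid.ker_prodMk {α β : Type*} (X : Ω → α) (Y : Ω → β) :
    Setoid.ker (fun ω => (X ω, Y ω)) = Setoid.ker X ⊓ Setoid.ker Y := by
  ext ω ω'
  refine Iff.trans ?_ Setoid.inf_iff_and.symm
  simp [Setoid.ker_def]

theorem Setoid.ker_pi {ι : Type*} {α : ι → Type*} (X : Ω → ∀ i, α i) :
    Setoid.ker X = ⨅ i, Setoid.ker (fun ω => X ω i) := by
  ext ω ω'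
  refine Iff.trans ?_ Setoid.sInf_iff.symm
  simp [Setoid.ker_def, funext_iff]

theorem Setoid.ker_pi_finset {ι : Type*} {α : Type*} (R : Finset ι) (X : ι → Ω → α) :
    Setoid.ker (fun ω (i : {x // x ∈ R}) => X i.1 ω) = ⨅ i ∈ R, Setoid.ker (X i) := by
  rw [Setoid.ker_pi, iInf_subtype']

end SetoidKer

section RetrievalEntropy

variable {Ω : Type*} [Fintype Ω] {p : Ω → ℝ}

theorem partH_iInf_inf_le_of_determined (hp0 : ∀ ω, 0 ≤ p ω) (hp1 : ∑ ω, p ω = 1) {ι : Type*}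
    {a c : ι → Setoid Ω} (h : ∀ i, partH p (a i ⊓ c i) ≤ partH p (c i)) (R : Finset ι)
    {y : Setoid Ω} (hy : ∀ i ∈ R, y ≤ c i) :
    partH p ((⨅ i ∈ R, a i) ⊓ y) ≤ partH p y := by
  classical
  induction R using Finset.induction_on with
  | empty => simp
  | insert i R hi ih =>
    rw [Finset.iInf_insert]
    have h1 := ih fun j hj => hy j (Finset.mem_insert_of_mem hj)
    have hyc := hy i (Finset.mem_insert_self i R)
    have h2 := partH_submodular' hp0 hp1 (x := a i ⊓ c i) (y := (⨅ i ∈ R, a i) ⊓ y) (z := c i)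
      (u := (a i ⊓ ⨅ i ∈ R, a i) ⊓ y) (by order) (by order) (by order)
    linarith [h i]

/-- Conditioned on the local queries `c`, anything determined by the messages and the local answers
is independent of the remaining queries. -/
theorem partH_condIndep_queries (hp0 : ∀ ω, 0 ≤ p ω) (hp1 : ∑ ω, p ω = 1)
    {W Q Q' s a c x : Setoid Ω} (hs : partH p s + partH p (W ⊓ Q) ≤ partH p (s ⊓ (W ⊓ Q)))
    (hq : partH p Q + partH p W ≤ partH p (Q ⊓ W))
    (ha : partH p (a ⊓ (c ⊓ W ⊓ s)) ≤ partH p (c ⊓ W ⊓ s))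
    (hQ : Q ≤ Q') (hc : Q' ≤ c) (hx : a ⊓ W ≤ x) :
    partH p (x ⊓ c) + partH p Q' ≤ partH p (x ⊓ Q') + partH p c := by
  have h1 := partH_submodular' hp0 hp1 (x := s ⊓ (a ⊓ (c ⊓ W))) (y := a ⊓ W ⊓ Q)
    (z := a ⊓ (c ⊓ W)) (u := s ⊓ (W ⊓ Q)) (by order) (by order) (by order)
  have h2 : partH p (s ⊓ (a ⊓ (c ⊓ W))) ≤ partH p (a ⊓ (c ⊓ W ⊓ s)) :=
    partH_anti hp0 (by order)
  have h3 : partH p (c ⊓ W ⊓ s) ≤ partH p (c ⊓ W) + partH p s := partH_inf_le hp0 hp1 _ _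
  have h4 : partH p (c ⊓ W) ≤ partH p c + partH p W := partH_inf_le hp0 hp1 _ _
  have h5 : partH p (Q ⊓ W) ≤ partH p (W ⊓ Q) := partH_anti hp0 (by order)
  have h6 := partH_submodular' hp0 hp1 (x := a ⊓ (c ⊓ W)) (y := x ⊓ Q)
    (z := x ⊓ c) (u := a ⊓ W ⊓ Q) (by order) (by order) (by order)
  have h7 := partH_submodular' hp0 hp1 (x := x ⊓ Q') (y := Q)
    (z := Q') (u := x ⊓ Q) (by order) (by order) (by order)
  linarith

/-- The recursive entropy bound relating the answers `a` to queries `q` with the answers `b` to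
queries `r`, for partitions of the sample space. -/
theorem partH_answers_recursion (hp0 : ∀ ω, 0 ≤ p ω) (hp1 : ∑ ω, p ω = 1)
    {ι κ : Type*} [Fintype ι] [DecidableEq ι] [Fintype κ] [DecidableEq κ]
    {w : κ → Setoid Ω} {a b q r : ι → Setoid Ω} {Q s : Setoid Ω}
    (hQq : ∀ n, Q ≤ q n) (hQr : ∀ n, Q ≤ r n)
    (hs : partH p s + partH p ((⨅ j, w j) ⊓ Q) ≤ partH p (s ⊓ ((⨅ j, w j) ⊓ Q)))
    (hq : partH p Q + partH p (⨅ j, w j) ≤ partH p (Q ⊓ ⨅ j, w j))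
    (ha : ∀ n, partH p (a n ⊓ (q n ⊓ (⨅ j, w j) ⊓ s)) ≤ partH p (q n ⊓ (⨅ j, w j) ⊓ s))
    (hb : ∀ n, partH p (b n ⊓ (r n ⊓ (⨅ j, w j) ⊓ s)) ≤ partH p (r n ⊓ (⨅ j, w j) ⊓ s))
    {L ε : ℝ} (hw : ∑ j, partH p (w j) ≤ partH p (⨅ j, w j)) (hL : ∀ j, partH p (w j) = L)
    {T : ℕ} {F : Finset ι} (hFT : F.card < T) (hT : T ≤ Fintype.card ι)
    (hsec : partH p (⨅ j, w j) + partH p ((⨅ n ∈ F, b n) ⊓ ⨅ n ∈ F, r n) ≤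
      partH p ((⨅ j, w j) ⊓ ((⨅ n ∈ F, b n) ⊓ ⨅ n ∈ F, r n)))
    {M : Finset κ} {i : κ} (hi : i ∉ M)
    (hpriv : ∀ 𝒯 : Finset ι, 𝒯.card = T → ∀ R ⊆ 𝒯,
      partH p ((⨅ n ∈ R, a n) ⊓ ((⨅ j ∈ M, w j) ⊓ ⨅ n ∈ 𝒯, q n)) =
        partH p ((⨅ n ∈ R, b n) ⊓ ((⨅ j ∈ M, w j) ⊓ ⨅ n ∈ 𝒯, r n)))
    (hcor : partH p (w i ⊓ ((⨅ n, b n) ⊓ ⨅ n, r n)) - partH p ((⨅ n, b n) ⊓ ⨅ n, r n) ≤ ε) :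
    ((T : ℝ) - F.card) / ((Fintype.card ι : ℝ) - F.card) *
      (partH p ((⨅ n ∈ Fᶜ, b n) ⊓ ((⨅ j ∈ insert i M, w j) ⊓ ((⨅ n ∈ F, b n) ⊓ ⨅ n, r n))) -
        partH p ((⨅ j ∈ insert i M, w j) ⊓ ((⨅ n ∈ F, b n) ⊓ ⨅ n, r n)) + L - ε) ≤
      partH p ((⨅ n ∈ Fᶜ, a n) ⊓ ((⨅ j ∈ M, w j) ⊓ ((⨅ n ∈ F, a n) ⊓ ⨅ n, q n))) -
        partH p ((⨅ j ∈ M, w j) ⊓ ((⨅ n ∈ F, a n) ⊓ ⨅ n, q n)) := by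
  set W := ⨅ j, w j with hW
  set m := ⨅ j ∈ M, w j with hm
  set u := ⨅ n, q n with hu
  set v := ⨅ n, r n with hv
  have hQu : Q ≤ u := le_iInf hQq
  have hQv : Q ≤ v := le_iInf hQr
  have hWm : W ≤ m := le_iInf₂ fun j _ => iInf_le w j
  have huR : ∀ R : Finset ι, u ≤ ⨅ n ∈ R, q n := fun R => le_iInf₂ fun n _ => iInf_le q n
  have hvR : ∀ R : Finset ι, v ≤ ⨅ n ∈ R, r n := fun R => le_iInf₂ fun n _ => iInf_le r n
  have haR : ∀ R : Finset ι, partH p ((⨅ n ∈ R, a n) ⊓ ((⨅ n ∈ R, q n) ⊓ W ⊓ s)) ≤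
      partH p ((⨅ n ∈ R, q n) ⊓ W ⊓ s) := fun R =>
    partH_iInf_inf_le_of_determined hp0 hp1 ha R fun n hn =>
      inf_le_inf_right _ (inf_le_inf_right _ (iInf₂_le n hn))
  have hbR : ∀ R : Finset ι, partH p ((⨅ n ∈ R, b n) ⊓ ((⨅ n ∈ R, r n) ⊓ W ⊓ s)) ≤
      partH p ((⨅ n ∈ R, r n) ⊓ W ⊓ s) := fun R =>
    partH_iInf_inf_le_of_determined hp0 hp1 hb R fun n hn =>
      inf_le_inf_right _ (inf_le_inf_right _ (iInf₂_le n hn))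
  -- the new messages stay uniform given the answers seen by `F` and all queries
  have hmsg : L ≤ partH p ((⨅ j ∈ insert i M, w j) ⊓ ((⨅ n ∈ F, b n) ⊓ v)) -
      partH p (m ⊓ ((⨅ n ∈ F, b n) ⊓ v)) := by
    set bF := ⨅ n ∈ F, b n
    set rF := ⨅ n ∈ F, r n
    have hvF : v ≤ rF := hvR F
    have h1 := partH_condIndep_queries hp0 hp1 hs hq (hbR F) hQv hvF (le_refl (bF ⊓ W))
    have h2 := partH_submodular' hp0 hp1 (x := bF ⊓ rF) (y := v) (z := rF) (u := bF ⊓ v)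
      (by order) (by order) (by order)
    have h3 : partH p (W ⊓ (bF ⊓ rF)) ≤ partH p (bF ⊓ W ⊓ rF) := partH_anti hp0 (by order)
    have h4 := partH_iInf_inf_le hp0 hp1 w (insert i M)ᶜ
      ((⨅ j ∈ insert i M, w j) ⊓ (bF ⊓ v))
    have h5 := partH_iInf_inf_le hp0 hp1 w M (bF ⊓ v)
    have h6 : partH p (bF ⊓ W ⊓ v) ≤
        partH p ((⨅ j ∈ (insert i M)ᶜ, w j) ⊓ ((⨅ j ∈ insert i M, w j) ⊓ (bF ⊓ v))) := by
      refine partH_anti hp0 ?_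
      have : (⨅ j ∈ (insert i M)ᶜ, w j) ⊓ (⨅ j ∈ insert i M, w j) ≤ W := by
        refine le_iInf fun j => ?_
        by_cases hj : j ∈ insert i M
        · exact inf_le_right.trans (iInf₂_le j hj)
        · exact inf_le_left.trans (iInf₂_le j (Finset.mem_compl.2 hj))
      order
    have h7 := Finset.sum_add_sum_compl (insert i M) fun j => partH p (w j)
    have h8 := Finset.sum_insert (f := fun j => partH p (w j)) hi
    have h9 := hL i
    linarith
  have hdec : partH p ((⨅ n ∈ Fᶜ, b n) ⊓ ((⨅ j ∈ insert i M, w j) ⊓ ((⨅ n ∈ F, b n) ⊓ v))) -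
      partH p ((⨅ j ∈ insert i M, w j) ⊓ ((⨅ n ∈ F, b n) ⊓ v)) + L - ε ≤
      partH p ((⨅ n ∈ Fᶜ, b n) ⊓ (m ⊓ ((⨅ n ∈ F, b n) ⊓ v))) -
      partH p (m ⊓ ((⨅ n ∈ F, b n) ⊓ v)) := by
    have hall : (⨅ n ∈ Fᶜ, b n) ⊓ (⨅ n ∈ F, b n) ≤ ⨅ n, b n := by
      refine le_iInf fun n => ?_
      by_cases hn : n ∈ F
      · exact inf_le_right.trans (iInf₂_le n hn)
      · exact inf_le_left.trans (iInf₂_le n (Finset.mem_compl.2 hn))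
    have hins : (⨅ j ∈ insert i M, w j) = w i ⊓ m := Finset.iInf_insert _ _ _
    have h1 := partH_submodular' hp0 hp1 (x := w i ⊓ ((⨅ n, b n) ⊓ v))
      (y := (⨅ n ∈ Fᶜ, b n) ⊓ (m ⊓ ((⨅ n ∈ F, b n) ⊓ v))) (z := (⨅ n, b n) ⊓ v)
      (u := (⨅ n ∈ Fᶜ, b n) ⊓ ((⨅ j ∈ insert i M, w j) ⊓ ((⨅ n ∈ F, b n) ⊓ v)))
      (by order) (by order) (by rw [hins]; order)
    linarith
  -- comparison for a single set of `T` servers, via privacy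
  have hcomp : ∀ R ⊆ Fᶜ, R.card = T - F.card →
      partH p ((⨅ n ∈ R, b n) ⊓ (m ⊓ ((⨅ n ∈ F, b n) ⊓ v))) -
        partH p (m ⊓ ((⨅ n ∈ F, b n) ⊓ v)) ≤
      partH p ((⨅ n ∈ Fᶜ, a n) ⊓ (m ⊓ ((⨅ n ∈ F, a n) ⊓ u))) -
        partH p (m ⊓ ((⨅ n ∈ F, a n) ⊓ u)) := by
    intro R hR hcard
    have hdisj : Disjoint R F := Finset.disjoint_left.2 fun x hx => Finset.mem_compl.1 (hR hx)
    have hTcard : (R ∪ F).card = T := by rw [Finset.card_union_of_disjoint hdisj]; omega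
    have p1 := hpriv _ hTcard _ (Finset.Subset.refl _)
    have p2 := hpriv _ hTcard F Finset.subset_union_right
    have h1 := partH_condIndep_queries hp0 hp1 hs hq (haR (R ∪ F)) hQu (huR _)
      (x := (⨅ n ∈ R ∪ F, a n) ⊓ m) (by order)
    have huT := huR (R ∪ F)
    have hvT := hvR (R ∪ F)
    set qT := ⨅ n ∈ R ∪ F, q n
    set rT := ⨅ n ∈ R ∪ F, r n
    have hsplit : ∀ c : ι → Setoid Ω,
        (⨅ n ∈ R ∪ F, c n) = (⨅ n ∈ R, c n) ⊓ ⨅ n ∈ F, c n := fun c => Finset.iInf_union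
    rw [hsplit a] at h1 p1
    rw [hsplit b] at p1
    have haRF : (⨅ n ∈ Fᶜ, a n) ≤ ⨅ n ∈ R, a n := le_iInf₂ fun n hn => iInf₂_le n (hR hn)
    set aR := ⨅ n ∈ R, a n
    set bR := ⨅ n ∈ R, b n
    set aF := ⨅ n ∈ F, a n
    set bF := ⨅ n ∈ F, b n
    set aC := ⨅ n ∈ Fᶜ, a n
    have h2 : partH p (aR ⊓ aF ⊓ m ⊓ u) ≤ partH p (aC ⊓ (m ⊓ (aF ⊓ u))) :=
      partH_anti hp0 (by order)
    have h3 := partH_submodular' hp0 hp1 (x := aF ⊓ (m ⊓ qT)) (y := u) (z := qT)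
      (u := m ⊓ (aF ⊓ u)) (by order) (by order) (by order)
    have h4 : partH p (aR ⊓ aF ⊓ (m ⊓ qT)) ≤ partH p (aR ⊓ aF ⊓ m ⊓ qT) :=
      partH_anti hp0 (by order)
    have h5 := partH_submodular' hp0 hp1 (x := bR ⊓ bF ⊓ (m ⊓ rT)) (y := m ⊓ (bF ⊓ v))
      (z := bF ⊓ (m ⊓ rT)) (u := bR ⊓ (m ⊓ (bF ⊓ v))) (by order) (by order) (by order)
    linarith
  have hFc : Fᶜ.card = (T - F.card) + (Fintype.card ι - T) := by
    rw [Finset.card_compl]; omega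
  obtain ⟨R, hRF, hRc, hle⟩ := exists_subset_card_eq_han
    (g := fun R => partH p ((⨅ n ∈ R, b n) ⊓ (m ⊓ ((⨅ n ∈ F, b n) ⊓ v))))
    (fun R R' => by
      refine partH_submodular' hp0 hp1 ?_ ?_ ?_
      · exact inf_le_inf_right _ (le_iInf₂ fun n hn => iInf₂_le n (Finset.mem_inter.1 hn).1)
      · exact inf_le_inf_right _ (le_iInf₂ fun n hn => iInf₂_le n (Finset.mem_inter.1 hn).2)
      · rw [Finset.iInf_union]
        order) Fᶜ (T - F.card) (Fintype.card ι - T) hFc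
  have h1 := hcomp R hRF hRc
  have hpos : (0 : ℝ) < (Fintype.card ι : ℝ) - F.card := by
    rw [sub_pos]; exact_mod_cast hFT.trans_le hT
  have hnn : (0 : ℝ) ≤ (T : ℝ) - F.card := by
    rw [sub_nonneg]; exact_mod_cast hFT.le
  rw [Finset.card_compl, Nat.cast_sub hFT.le, Nat.cast_sub (hFT.le.trans hT)] at hle
  simp only [Finset.notMem_empty, iInf_false, iInf_top, top_inf_eq] at hle
  rw [div_mul_eq_mul_div, div_le_iff₀ hpos]
  have h2 := mul_le_mul_of_nonneg_left hdec hnn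
  have h3 := mul_le_mul_of_nonneg_left h1 hpos.le
  linarith

theorem iInf_castLE {κ : Type*} [CompleteLattice κ] {m K : ℕ} (h : m ≤ K) (w : Fin K → κ) :
    ⨅ j : Fin m, w (Fin.castLE h j) = ⨅ j ∈ Finset.univ.filter (fun j : Fin K => j.val < m), w j := by
  refine le_antisymm (le_iInf₂ fun j hj => ?_) (le_iInf fun j => iInf₂_le _ (by simp))
  exact iInf_le (fun j : Fin m => w (Fin.castLE h j)) ⟨j, by simpa using hj⟩

end RetrievalEntropy

/-- Lemma 3 of the ETPIR paper: recursive (inductive) relationship between the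
answers with respect to message `k` and message `k+1` (paper indices; here the
messages are 0-indexed, so `k` ranges over `[0 : K-2]`). -/
theorem stmt_2
    {Ω 𝕎 𝔹 𝔸 𝕊 : Type} [Fintype Ω] [Fintype 𝕎] [DecidableEq 𝕎]
    [Fintype 𝔹] [DecidableEq 𝔹] [Fintype 𝔸] [DecidableEq 𝔸]
    [Fintype 𝕊] [DecidableEq 𝕊]
    {K N E T : ℕ} (hET : E < T) (hTN : T ≤ N)
    (p : Ω → ℝ) (hp0 : ∀ ω, 0 ≤ p ω) (hp1 : ∑ ω, p ω = 1)
    (W : Fin K → Ω → 𝕎) (Q : Fin N → Fin K → Ω → 𝔹)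
    (A : Fin N → Fin K → Ω → 𝔸) (S : Ω → 𝕊)
    (L ε : ℝ)
    -- (i) the queries are independent of the messages
    (hQW : mutInfH p (fun ω (n : Fin N) (k : Fin K) => Q n k ω) (fun ω k => W k ω) = 0)
    -- (ii) the common randomness is independent of the messages and queries
    (hS : mutInfH p S
      (fun ω => ((fun k => W k ω), (fun (n : Fin N) (k : Fin K) => Q n k ω))) = 0)
    -- (iii) the answers are deterministic functions of query, messages and `S`
    (hA : ∀ (n : Fin N) (k : Fin K),
      condEntH p (A n k) (fun ω => (Q n k ω, (fun j => W j ω), S ω)) = 0)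
    -- the messages are mutually independent
    (hind : ∀ w : Fin K → 𝕎,
      prC p (fun ω k => W k ω) w = ∏ k, prC p (W k) (w k))
    -- each message has entropy `L`
    (hW : ∀ k : Fin K, entH p (W k) = L)
    -- E-security
    (hsec : ∀ ℰ : Finset (Fin N), ℰ.card = E → ∀ k : Fin K,
      mutInfH p (fun ω j => W j ω)
        (fun ω => ((fun (n : {x // x ∈ ℰ}) => A n.1 k ω),
                   (fun (n : {x // x ∈ ℰ}) => Q n.1 k ω))) = 0)
    -- T-privacy
    (hpriv : ∀ 𝒯 : Finset (Fin N), 𝒯.card = T → ∀ k k' : Fin K,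
      ∀ z, prC p (fun ω => ((fun (n : {x // x ∈ 𝒯}) => A n.1 k ω),
                            (fun (n : {x // x ∈ 𝒯}) => Q n.1 k ω),
                            (fun j => W j ω), S ω)) z
         = prC p (fun ω => ((fun (n : {x // x ∈ 𝒯}) => A n.1 k' ω),
                            (fun (n : {x // x ∈ 𝒯}) => Q n.1 k' ω),
                            (fun j => W j ω), S ω)) z)
    (k : ℕ) (hk : k + 1 < K)
    -- ε-correctness for message k+1
    (hcor : condEntH p (W ⟨k + 1, hk⟩)
      (fun ω => ((fun (n : Fin N) => A n ⟨k + 1, hk⟩ ω),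
                 (fun (n : Fin N) => Q n ⟨k + 1, hk⟩ ω))) ≤ ε) :
    ∀ ℰ : Finset (Fin N), ℰ.card = E →
      condEntH p (fun ω (n : {x // x ∈ ℰᶜ}) => A n.1 ⟨k, by omega⟩ ω)
          (fun ω => ((fun (j : Fin (k + 1)) => W (Fin.castLE (by omega) j) ω),
                     (fun (n : {x // x ∈ ℰ}) => A n.1 ⟨k, by omega⟩ ω),
                     (fun (n : Fin N) => Q n ⟨k, by omega⟩ ω)))
        ≥ (((T : ℝ) - E) / ((N : ℝ) - E)) *
            (condEntH p (fun ω (n : {x // x ∈ ℰᶜ}) => A n.1 ⟨k + 1, hk⟩ ω)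
              (fun ω => ((fun (j : Fin (k + 2)) => W (Fin.castLE (by omega) j) ω),
                         (fun (n : {x // x ∈ ℰ}) => A n.1 ⟨k + 1, hk⟩ ω),
                         (fun (n : Fin N) => Q n ⟨k + 1, hk⟩ ω)))
              + L - ε) := by
  classical
  intro ℰ hℰ
  have kW : Setoid.ker (fun ω j => W j ω) = ⨅ j, Setoid.ker (W j) := Setoid.ker_pi _
  have kQ : Setoid.ker (fun ω (n : Fin N) (k : Fin K) => Q n k ω) =
      ⨅ n, ⨅ k, Setoid.ker (Q n k) := by
    rw [Setoid.ker_pi]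
    exact iInf_congr fun n => Setoid.ker_pi _
  have kQk : ∀ k, Setoid.ker (fun ω (n : Fin N) => Q n k ω) = ⨅ n, Setoid.ker (Q n k) :=
    fun k => Setoid.ker_pi _
  have kAk : ∀ k, Setoid.ker (fun ω (n : Fin N) => A n k ω) = ⨅ n, Setoid.ker (A n k) :=
    fun k => Setoid.ker_pi _
  have kQR : ∀ (R : Finset (Fin N)) k, Setoid.ker (fun ω (n : {x // x ∈ R}) => Q n.1 k ω) =
      ⨅ n ∈ R, Setoid.ker (Q n k) := fun R k => Setoid.ker_pi_finset R fun n => Q n k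
  have kAR : ∀ (R : Finset (Fin N)) k, Setoid.ker (fun ω (n : {x // x ∈ R}) => A n.1 k ω) =
      ⨅ n ∈ R, Setoid.ker (A n k) := fun R k => Setoid.ker_pi_finset R fun n => A n k
  have kWm : ∀ (m : ℕ) (hm : m ≤ K),
      Setoid.ker (fun ω (j : Fin m) => W (Fin.castLE hm j) ω) =
        ⨅ j ∈ Finset.univ.filter (fun j : Fin K => j.val < m), Setoid.ker (W j) := fun m hm =>
    (Setoid.ker_pi _).trans (iInf_castLE hm fun j => Setoid.ker (W j))
  have hk' : k < K := by omega
  have hwsum := entH_pi_of_independent hp0 W hind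
  simp only [mutInfH, condEntH, entH_eq_partH, Setoid.ker_prodMk, kW, kQ, kQk, kAk, kQR, kAR, kWm]
    at hQW hS hA hW hsec hcor hwsum ⊢
  have hins : Finset.univ.filter (fun j : Fin K => j.val < k + 2) =
      insert ⟨k + 1, hk⟩ (Finset.univ.filter fun j : Fin K => j.val < k + 1) := by
    ext j
    simp only [Finset.mem_filter, Finset.mem_univ, true_and, Finset.mem_insert, Fin.ext_iff]
    omega
  have hpriv' : ∀ 𝒯 : Finset (Fin N), 𝒯.card = T → ∀ R ⊆ 𝒯,
      partH p ((⨅ n ∈ R, Setoid.ker (A n ⟨k, hk'⟩)) ⊓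
        ((⨅ j ∈ Finset.univ.filter (fun j : Fin K => j.val < k + 1), Setoid.ker (W j)) ⊓
          ⨅ n ∈ 𝒯, Setoid.ker (Q n ⟨k, hk'⟩))) =
      partH p ((⨅ n ∈ R, Setoid.ker (A n ⟨k + 1, hk⟩)) ⊓
        ((⨅ j ∈ Finset.univ.filter (fun j : Fin K => j.val < k + 1), Setoid.ker (W j)) ⊓
          ⨅ n ∈ 𝒯, Setoid.ker (Q n ⟨k + 1, hk⟩))) := by
    intro 𝒯 h𝒯 R hR
    have := entH_comp_congr (hpriv 𝒯 h𝒯 ⟨k, hk'⟩ ⟨k + 1, hk⟩)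
      (fun z => ((fun n : {x // x ∈ R} => z.1 ⟨n.1, hR n.2⟩),
        (fun j : Fin (k + 1) => z.2.2.1 (Fin.castLE hk.le j)), z.2.1))
    simpa only [entH_eq_partH, Setoid.ker_prodMk, kQR, kAR, kWm] using this
  have main := partH_answers_recursion hp0 hp1 (w := fun j => Setoid.ker (W j))
    (a := fun n => Setoid.ker (A n ⟨k, hk'⟩)) (b := fun n => Setoid.ker (A n ⟨k + 1, hk⟩))
    (q := fun n => Setoid.ker (Q n ⟨k, hk'⟩)) (r := fun n => Setoid.ker (Q n ⟨k + 1, hk⟩))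
    (Q := ⨅ n, ⨅ k, Setoid.ker (Q n k)) (s := Setoid.ker S) (L := L) (ε := ε) (T := T) (F := ℰ)
    (M := Finset.univ.filter fun j : Fin K => j.val < k + 1) (i := ⟨k + 1, hk⟩)
    (fun n => (iInf_le _ n).trans (iInf_le _ _)) (fun n => (iInf_le _ n).trans (iInf_le _ _))
    (by linarith) (by linarith)
    (fun n => by rw [inf_assoc]; linarith [hA n ⟨k, hk'⟩])
    (fun n => by rw [inf_assoc]; linarith [hA n ⟨k + 1, hk⟩])
    hwsum.ge hW (by omega) (by simpa using hTN)
    (by linarith [hsec ℰ hℰ ⟨k + 1, hk⟩]) (by simp) hpriv' hcor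
  rw [hins, ge_iff_le]
  simpa only [hℰ, Fintype.card_fin] using main
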